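/- arXiv:2501.00266 — 2 statements merged into one kernel-verified Lean document; each statement's English description precedes it below -/
import Mathlib

section
/- Let F be a one-step skew product satisfying conditions (H0), (H1), (H2), and the pointwise-fiber fluctuation law with constants γ₀ < γ₁ in (0,1): there exist x₀, x₁ ∈ (0,1) such that for i = 0,1 and every α ∈ (0,1), liminf_{n→∞} ℙ( { ω : (1/n)∑_{j=0}^{n-1} 1_{I_i(γ_i)}(f_ω^j(x_i)) ≤ α } ) < 1. Then for every x ∈ (0,1), for ℙ-almost every ω ∈ Ω one has liminf_{n→∞} (1/n)∑_{j=0}^{n-1} f_ω^j(x) ≤ γ₀ and limsup_{n→∞} (1/n)∑_{j=0}^{n-1} f_ω^j(x) ≥ γ₁; in particular, for every x ∈ (0,1) the Birkhoff averages (1/n)∑_{j=0}^{n-1} f_ω^j(x) fail to converge for ℙ-almost every ω. -/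
open MeasureTheory Filter Set

noncomputable section

/-- Fiber compositions of a one-step skew product:
`fib f ω n = f_{ω_{n-1}} ∘ ⋯ ∘ f_{ω_0}`. -/
def fib {𝒜 : Type*} (f : 𝒜 → ℝ → ℝ) (ω : ℕ → 𝒜) : ℕ → ℝ → ℝ
  | 0 => id
  | n + 1 => f (ω n) ∘ fib f ω n

/-- `ℙ` is the Bernoulli product measure `p^ℕ` on `𝒜^ℕ`, characterized by its values on
cylinder sets. -/
def IsBernoulli {𝒜 : Type*} [MeasurableSpace 𝒜] (p : Measure 𝒜) (ℙ : Measure (ℕ → 𝒜)) : Prop :=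
  ∀ (n : ℕ) (s : Fin n → Set 𝒜), (∀ i, MeasurableSet (s i)) →
    ℙ {ω : ℕ → 𝒜 | ∀ i : Fin n, ω (i : ℕ) ∈ s i} = ∏ i, p (s i)

/-- The tail σ-algebra generated by the real random variables `X m, X (m+1), …`
is `ℙ`-trivial. -/
def TailTrivial {Ω : Type*} [MeasurableSpace Ω] (ℙ : Measure Ω) (X : ℕ → Ω → ℝ) : Prop :=
  ∀ s : Set Ω,
    MeasurableSet[⨅ m : ℕ, ⨆ (n : ℕ) (_ : m ≤ n),
      MeasurableSpace.comap (X n) (inferInstance : MeasurableSpace ℝ)] s →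
    ℙ s = 0 ∨ ℙ s = 1

/-- `limsup` of the averages of `u` is at least `c`. -/
def Lf (c : ℝ) (u : ℕ → ℝ) : Prop :=
  ∀ q : ℚ, (q : ℝ) < c → ∀ N : ℕ, ∃ n ≥ N, (q : ℝ) * n < ∑ j ∈ Finset.range n, u j

lemma Lf_shift_one (c : ℝ) (u : ℕ → ℝ) (h0 : ∀ j, 0 ≤ u j) (h1 : ∀ j, u j ≤ 1) :
    Lf c u ↔ Lf c (fun j => u (j + 1)) := by
  constructor
  · intro h q hq N
    obtain ⟨r, hqr, hrc⟩ := exists_rat_btwn hq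
    have hd : 0 < (r : ℝ) - q := sub_pos.2 hqr
    obtain ⟨M, hM⟩ := exists_nat_ge ((1 - (q : ℝ)) / ((r : ℝ) - q))
    rw [div_le_iff₀ hd] at hM
    obtain ⟨n, hn, hlt⟩ := h r hrc (max N M + 1)
    obtain ⟨k, rfl⟩ : ∃ k, n = k + 1 := ⟨n - 1, by omega⟩
    have hN : N ≤ k := le_trans (le_max_left N M) (by omega)
    have hMk : M ≤ k := le_trans (le_max_right N M) (by omega)
    refine ⟨k, hN, ?_⟩
    rw [Finset.sum_range_succ'] at hlt
    have := h1 0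
    have hMk' : (M : ℝ) ≤ k := by exact_mod_cast hMk
    push_cast at hlt
    nlinarith
  · intro h q hq N
    obtain ⟨r, hqr, hrc⟩ := exists_rat_btwn hq
    have hd : 0 < (r : ℝ) - q := sub_pos.2 hqr
    obtain ⟨M, hM⟩ := exists_nat_ge ((q : ℝ) / ((r : ℝ) - q))
    rw [div_le_iff₀ hd] at hM
    obtain ⟨k, hn, hlt⟩ := h r hrc (max N M)
    have hN : N ≤ k := le_trans (le_max_left N M) (by omega)
    have hMk : M ≤ k := le_trans (le_max_right N M) (by omega)
    refine ⟨k + 1, by omega, ?_⟩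
    rw [Finset.sum_range_succ']
    have := h0 0
    have hMk' : (M : ℝ) ≤ k := by exact_mod_cast hMk
    push_cast
    nlinarith

lemma Lf_shift (c : ℝ) (u : ℕ → ℝ) (h0 : ∀ j, 0 ≤ u j) (h1 : ∀ j, u j ≤ 1) (m : ℕ) :
    Lf c u ↔ Lf c (fun j => u (j + m)) := by
  induction m with
  | zero => rfl
  | succ m ih =>
    rw [ih, Lf_shift_one c (fun j => u (j + m)) (fun j => h0 _) (fun j => h1 _)]
    have e : (fun j => u (j + 1 + m)) = fun j => u (j + (m + 1)) := by
      funext j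
      congr 1
      omega
    exact iff_of_eq (congrArg (Lf c) e)

lemma Lf_mono (c : ℝ) (u v : ℕ → ℝ) (h : ∀ j, u j ≤ v j) (hu : Lf c u) : Lf c v := by
  intro q hq N
  obtain ⟨n, hn, hlt⟩ := hu q hq N
  exact ⟨n, hn, hlt.trans_le (Finset.sum_le_sum fun j _ => h j)⟩

lemma Lf_meas {Ω : Type*} [MeasurableSpace Ω] (c : ℝ) (v : ℕ → Ω → ℝ)
    (hv : ∀ j, Measurable (v j)) : MeasurableSet {ω | Lf c (fun j => v j ω)} := by
  have : {ω | Lf c (fun j => v j ω)} = ⋂ (q : ℚ) (_ : (q : ℝ) < c) (N : ℕ), ⋃ (n : ℕ) (_ : n ≥ N),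
      {ω | (q : ℝ) * n < ∑ j ∈ Finset.range n, v j ω} := by
    ext ω
    simp [Lf]
  rw [this]
  refine MeasurableSet.iInter fun q => MeasurableSet.iInter fun _ => MeasurableSet.iInter fun N =>
    MeasurableSet.iUnion fun n => MeasurableSet.iUnion fun _ => ?_
  exact measurableSet_lt measurable_const (Finset.measurable_sum _ fun j _ => hv j)

lemma ind_nonneg (J : Set ℝ) (y : ℝ) : 0 ≤ J.indicator (1 : ℝ → ℝ) y :=
  Set.indicator_nonneg (fun _ _ => zero_le_one) y

lemma ind_le_one (J : Set ℝ) (y : ℝ) : J.indicator (1 : ℝ → ℝ) y ≤ 1 :=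
  Set.indicator_le' (fun _ _ => le_rfl) (fun _ _ => zero_le_one) y

lemma Lf_tail {Ω : Type*} (X : ℕ → Ω → ℝ) (J : Set ℝ) (hJ : MeasurableSet J) (c : ℝ) :
    MeasurableSet[⨅ m : ℕ, ⨆ (n : ℕ) (_ : m ≤ n),
      MeasurableSpace.comap (X n) (inferInstance : MeasurableSpace ℝ)]
      {ω | Lf c (fun j => J.indicator 1 (X j ω))} := by
  rw [MeasurableSpace.measurableSet_iInf]
  intro m
  have : {ω | Lf c (fun j => J.indicator 1 (X j ω))}
      = {ω | Lf c (fun j => J.indicator 1 (X (j + m) ω))} := by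
    ext ω
    exact Lf_shift c (fun j => J.indicator 1 (X j ω)) (fun j => ind_nonneg J _)
      (fun j => ind_le_one J _) m
  rw [this]
  refine @Lf_meas Ω (_) c (fun j ω => J.indicator 1 (X (j + m) ω)) fun j => ?_
  refine Measurable.comp (g := J.indicator (1 : ℝ → ℝ)) (measurable_one.indicator hJ) ?_
  refine Measurable.mono (comap_measurable (X (j + m))) ?_ le_rfl
  exact le_iSup₂ (f := fun (n : ℕ) (_ : m ≤ n) =>
    MeasurableSpace.comap (X n) (inferInstance : MeasurableSpace ℝ)) (j + m) (by omega)

lemma fib_succ' {𝒜 : Type*} (f : 𝒜 → ℝ → ℝ) (ω : ℕ → 𝒜) (n : ℕ) (x : ℝ) :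
    fib f ω (n + 1) x = fib f (fun k => ω (k + 1)) n (f (ω 0) x) := by
  induction n with
  | zero => rfl
  | succ n ih =>
    change f (ω (n + 1)) (fib f ω (n + 1) x) = f (ω (n + 1)) (fib f _ n _)
    rw [ih]

lemma fib_meas {𝒜 : Type*} [Countable 𝒜] [MeasurableSpace 𝒜] [MeasurableSingletonClass 𝒜]
    (f : 𝒜 → ℝ → ℝ) (hfm : ∀ c, Measurable (f c)) (x : ℝ) (n : ℕ) :
    Measurable fun ω => fib f ω n x := by
  induction n with
  | zero => exact measurable_const
  | succ n ih =>
    have h : Measurable fun z : ℝ × 𝒜 => f z.2 z.1 :=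
      measurable_from_prod_countable_left fun c => hfm c
    exact h.comp (ih.prodMk (measurable_pi_apply n))

lemma fib_mem {𝒜 : Type*} (f : 𝒜 → ℝ → ℝ)
    (hH1 : ∀ c, MapsTo (f c) (Ioo (0:ℝ) 1) (Ioo (0:ℝ) 1) ∧ MonotoneOn (f c) (Ioo (0:ℝ) 1))
    (ω : ℕ → 𝒜) (n : ℕ) (x : ℝ) (hx : x ∈ Ioo (0:ℝ) 1) : fib f ω n x ∈ Ioo (0:ℝ) 1 := by
  induction n with
  | zero => exact hx
  | succ n ih => exact (hH1 _).1 ih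

lemma fib_mono {𝒜 : Type*} (f : 𝒜 → ℝ → ℝ)
    (hH1 : ∀ c, MapsTo (f c) (Ioo (0:ℝ) 1) (Ioo (0:ℝ) 1) ∧ MonotoneOn (f c) (Ioo (0:ℝ) 1))
    (ω : ℕ → 𝒜) (n : ℕ) (x y : ℝ) (hx : x ∈ Ioo (0:ℝ) 1) (hy : y ∈ Ioo (0:ℝ) 1) (hxy : x ≤ y) :
    fib f ω n x ≤ fib f ω n y := by
  induction n with
  | zero => exact hxy
  | succ n ih =>
    exact (hH1 _).2 (fib_mem f hH1 ω n x hx) (fib_mem f hH1 ω n y hy) ih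

lemma bern_pi {𝒜 : Type*} [MeasurableSpace 𝒜]
    (p : Measure 𝒜) [IsProbabilityMeasure p]
    (ℙ : Measure (ℕ → 𝒜)) (hPr : IsBernoulli p ℙ) : ℙ = Measure.infinitePi fun _ => p := by
  classical
  apply Measure.eq_infinitePi
  intro s t ht
  have h := hPr (s.sup id + 1) (fun i => if (i : ℕ) ∈ s then t i else univ)
    (fun i => by split_ifs; exacts [ht _, MeasurableSet.univ])
  have hs : ∀ i ∈ s, i < s.sup id + 1 := fun i hi =>
    Nat.lt_succ_of_le (Finset.le_sup (f := id) hi)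
  convert h using 1
  · congr 1
    ext ω
    simp only [Set.mem_pi, Finset.mem_coe, mem_ofPred_eq]
    constructor
    · intro h i
      split_ifs with hi
      exacts [h i hi, mem_univ _]
    · intro h i hi
      have := h ⟨i, hs i hi⟩
      simpa [hi] using this
  · rw [Fin.prod_univ_eq_prod_range (fun i => p (if i ∈ s then t i else univ))]
    rw [← Finset.prod_subset (s₁ := s) (s₂ := Finset.range (s.sup id + 1))]
    · exact Finset.prod_congr rfl fun i hi => by rw [if_pos hi]
    · intro i hi
      exact Finset.mem_range.2 (hs i hi)
    · intro i _ hi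
      rw [if_neg hi, measure_univ]

lemma bern_shift {𝒜 : Type*} [MeasurableSpace 𝒜] [MeasurableSingletonClass 𝒜]
    (p : Measure 𝒜) [IsProbabilityMeasure p] (hp : ∀ c : 𝒜, 0 < p {c})
    (ℙ : Measure (ℕ → 𝒜)) (hPr : IsBernoulli p ℙ) (c : 𝒜) (B : Set (ℕ → 𝒜))
    (hB : MeasurableSet B) :
    ℙ {ω | ω 0 = c ∧ (fun k => ω (k + 1)) ∈ B} = p {c} * ℙ B := by
  classical
  have hσ : Measurable fun (ω : ℕ → 𝒜) (k : ℕ) => ω (k + 1) := by fun_prop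
  have hc : MeasurableSet {ω : ℕ → 𝒜 | ω 0 = c} :=
    (measurable_pi_apply (X := fun _ : ℕ => 𝒜) 0) (measurableSet_singleton c)
  set ν : Measure (ℕ → 𝒜) := (p {c})⁻¹ •
    Measure.map (fun (ω : ℕ → 𝒜) (k : ℕ) => ω (k + 1)) (ℙ.restrict {ω | ω 0 = c}) with hν
  have hne : p {c} ≠ 0 := (hp c).ne'
  have hnt : p {c} ≠ ⊤ := measure_ne_top _ _
  have hval : ∀ B, MeasurableSet B → ν B =
      (p {c})⁻¹ * ℙ {ω | ω 0 = c ∧ (fun k => ω (k + 1)) ∈ B} := by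
    intro B hB
    rw [hν, Measure.smul_apply, Measure.map_apply hσ hB, Measure.restrict_apply (hσ hB),
      smul_eq_mul]
    congr 2
    ext ω
    simp [and_comm]
  have hPi := bern_pi p ℙ hPr
  have hνP : ν = ℙ := by
    rw [hPi]
    apply Measure.eq_infinitePi
    intro s t ht
    rw [hval _ (MeasurableSet.pi s.countable_toSet fun i _ => ht i), hPi]
    have : {ω : ℕ → 𝒜 | ω 0 = c ∧ (fun k => ω (k + 1)) ∈ Set.pi s t} =
        Set.pi (insert 0 (s.image Nat.succ) : Finset ℕ)
          (fun n : ℕ => (Nat.casesOn n ({c} : Set 𝒜) t : Set 𝒜)) := by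
      ext ω
      simp [Set.mem_pi]
    rw [this, Measure.infinitePi_pi]
    · rw [Finset.prod_insert (by simp), Finset.prod_image (by simp)]
      change (p {c})⁻¹ * (p {c} * ∏ i ∈ s, p (t i)) = _
      rw [← mul_assoc, ENNReal.inv_mul_cancel hne hnt, one_mul]
    · intro i _
      cases i
      exacts [measurableSet_singleton c, ht _]
  rw [← hνP, hval B hB, hνP, ← mul_assoc, ENNReal.mul_inv_cancel hne hnt, one_mul]

section main
variable {𝒜 : Type*} [Countable 𝒜] [MeasurableSpace 𝒜] [MeasurableSingletonClass 𝒜]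

/-- The fluctuation event. -/
def Ev (f : 𝒜 → ℝ → ℝ) (J : Set ℝ) (c : ℝ) (x : ℝ) : Set (ℕ → 𝒜) :=
  {ω | Lf c (fun j => J.indicator 1 (fib f ω j x))}

lemma Ev_meas (f : 𝒜 → ℝ → ℝ) (hfm : ∀ c, Measurable (f c)) (J : Set ℝ) (hJ : MeasurableSet J)
    (c x : ℝ) : MeasurableSet (Ev f J c x) :=
  Lf_meas c (fun j ω => J.indicator 1 (fib f ω j x))
    fun j => Measurable.comp (g := J.indicator (1 : ℝ → ℝ)) (measurable_one.indicator hJ)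
      (fib_meas f hfm x j)

lemma Ev_shift (f : 𝒜 → ℝ → ℝ) (J : Set ℝ) (c x : ℝ) (ω : ℕ → 𝒜) :
    ω ∈ Ev f J c x ↔ (fun k => ω (k + 1)) ∈ Ev f J c (f (ω 0) x) := by
  have := Lf_shift_one c (fun j => J.indicator 1 (fib f ω j x)) (fun j => ind_nonneg J _)
      (fun j => ind_le_one J _)
  simpa only [Ev, mem_ofPred_eq, fib_succ'] using this

lemma Ev_pre (p : Measure 𝒜) [IsProbabilityMeasure p] (hp : ∀ c : 𝒜, 0 < p {c})
    (ℙ : Measure (ℕ → 𝒜)) [IsProbabilityMeasure ℙ] (hPr : IsBernoulli p ℙ)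
    (f : 𝒜 → ℝ → ℝ) (hfm : ∀ c, Measurable (f c))
    (hH0 : ∀ x ∈ Ioo (0:ℝ) 1, TailTrivial ℙ fun n ω => fib f ω n x)
    (J : Set ℝ) (hJ : MeasurableSet J)
    (c x : ℝ) (hx : x ∈ Ioo (0:ℝ) 1) (a : 𝒜) (h : ℙ (Ev f J c (f a x)) = 1) :
    ℙ (Ev f J c x) = 1 := by
  refine (hH0 x hx _ (Lf_tail _ J hJ c)).resolve_left ?_
  intro h0
  have h1 := bern_shift p hp ℙ hPr a _ (Ev_meas f hfm J hJ c (f a x))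
  rw [h, mul_one] at h1
  have h2 : p {a} ≤ ℙ (Ev f J c x) := by
    rw [← h1]
    apply measure_mono
    rintro ω ⟨rfl, hω⟩
    exact (Ev_shift f J c x ω).2 hω
  exact absurd (h2.trans h0.le) (not_le.2 (hp a))

lemma Ev_im (p : Measure 𝒜) [IsProbabilityMeasure p] (hp : ∀ c : 𝒜, 0 < p {c})
    (ℙ : Measure (ℕ → 𝒜)) [IsProbabilityMeasure ℙ] (hPr : IsBernoulli p ℙ)
    (f : 𝒜 → ℝ → ℝ) (hfm : ∀ c, Measurable (f c))
    (J : Set ℝ) (hJ : MeasurableSet J)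
    (c x : ℝ) (a : 𝒜) (h : ℙ (Ev f J c x) = 1) :
    ℙ (Ev f J c (f a x)) = 1 := by
  have hm := Ev_meas f hfm J hJ c (f a x)
  have h1 := bern_shift p hp ℙ hPr a _ hm.compl
  have h0 : ℙ (Ev f J c x)ᶜ = 0 := (prob_compl_eq_zero_iff (Ev_meas f hfm J hJ c x)).2 h
  rw [measure_mono_null _ h0, eq_comm, mul_eq_zero] at h1
  · exact (prob_compl_eq_zero_iff hm).1 (h1.resolve_left (hp a).ne')
  · rintro ω ⟨rfl, hω⟩ h
    exact hω ((Ev_shift f J c x ω).1 h)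

lemma Ev_start (ℙ : Measure (ℕ → 𝒜)) [IsProbabilityMeasure ℙ]
    (f : 𝒜 → ℝ → ℝ) (hfm : ∀ c, Measurable (f c))
    (hH0 : ∀ x ∈ Ioo (0:ℝ) 1, TailTrivial ℙ fun n ω => fib f ω n x)
    (J : Set ℝ) (hJ : MeasurableSet J)
    (x : ℝ) (hx : x ∈ Ioo (0:ℝ) 1) (hFL : ∀ α ∈ Ioo (0:ℝ) 1,
      Filter.liminf (fun n : ℕ => ℙ {ω | (n:ℝ)⁻¹ *
        ∑ j ∈ Finset.range n, J.indicator 1 (fib f ω j x) ≤ α}) atTop < 1) :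
    ℙ (Ev f J 1 x) = 1 := by
  have key : ∀ α ∈ Ioo (0:ℝ) 1, ℙ (Ev f J α x) = 1 := by
    intro α hα
    refine (hH0 x hx _ (Lf_tail _ J hJ α)).resolve_left ?_
    intro h0
    change ℙ (Ev f J α x) = 0 at h0
    obtain ⟨b, hb, hb1⟩ := exists_between (hFL α hα)
    have hfr := frequently_lt_of_liminf_lt (by isBoundedDefault) hb
    let T : ℕ → Set (ℕ → 𝒜) := fun N => {ω | ∀ n ≥ N, (n:ℝ)⁻¹ *
        ∑ j ∈ Finset.range n, J.indicator 1 (fib f ω j x) ≤ α}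
    have hTm : Monotone T := fun M N hMN ω hω n hn => hω n (hMN.trans hn)
    have hsub : (⋃ N, T N)ᶜ ⊆ Ev f J α x := by
      intro ω hω q hq N
      simp only [T, mem_compl_iff, mem_iUnion, mem_ofPred_eq, not_exists, not_forall, not_le] at hω
      obtain ⟨n, hn, hlt⟩ := hω (N + 1)
      refine ⟨n, by omega, ?_⟩
      have hn0 : (0 : ℝ) < n := by
        have : 0 < n := by omega
        exact_mod_cast this
      have h2 := hq.trans hlt
      rw [inv_mul_eq_div, lt_div_iff₀ hn0] at h2
      exact h2
    have hU : ℙ (⋃ N, T N) = 1 := by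
      have hae : ∀ᵐ ω ∂ℙ, ω ∈ ⋃ N, T N := by
        rw [ae_iff]
        exact measure_mono_null hsub h0
      rw [measure_congr (show (⋃ N, T N) =ᵐ[ℙ] univ from eventuallyEq_univ.2 hae), measure_univ]
    have htend := tendsto_measure_iUnion_atTop (μ := ℙ) hTm
    rw [hU] at htend
    obtain ⟨N, hN⟩ := (htend.eventually (lt_mem_nhds hb1)).exists
    obtain ⟨n, hn, hlt⟩ := (frequently_atTop.1 hfr) N
    have : ℙ (T N) ≤ _ := measure_mono (fun ω hω => hω n hn)
    exact absurd (hN.trans_le this) (not_lt.2 hlt.le)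
  have hall : ∀ᵐ ω ∂ℙ, ∀ k : ℕ, ω ∈ Ev f J (1 - 1 / ((k : ℝ) + 2)) x := by
    rw [ae_all_iff]
    intro k
    have hk : (0 : ℝ) ≤ k := Nat.cast_nonneg k
    refine (prob_compl_eq_zero_iff (Ev_meas f hfm J hJ _ x)).2 (key _ ⟨?_, ?_⟩)
    · rw [sub_pos, div_lt_one (by positivity)]
      linarith
    · have : 0 < 1 / ((k : ℝ) + 2) := by positivity
      linarith
  refine (prob_compl_eq_zero_iff (Ev_meas f hfm J hJ _ x)).1 ?_
  change ∀ᵐ ω ∂ℙ, ω ∈ Ev f J 1 x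
  filter_upwards [hall] with ω hω q hq N
  obtain ⟨k, hk⟩ := exists_nat_one_div_lt (sub_pos.2 hq)
  refine hω k q ?_ N
  have : 1 / ((k : ℝ) + 2) ≤ 1 / ((k : ℝ) + 1) := by
    apply one_div_le_one_div_of_le <;> [positivity; linarith]
  linarith

lemma set_all (f : 𝒜 → ℝ → ℝ) (hH1 : ∀ c, MapsTo (f c) (Ioo (0:ℝ) 1) (Ioo (0:ℝ) 1))
    (hH2 : ∀ x ∈ Ioo (0:ℝ) 1, ∃ a b : 𝒜, f a x < x ∧ x < f b x)
    (P : ℝ → Prop) (hpre : ∀ x ∈ Ioo (0:ℝ) 1, ∀ a, P (f a x) → P x)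
    (him : ∀ x ∈ Ioo (0:ℝ) 1, ∀ a, P x → P (f a x))
    (hmono : ∀ x ∈ Ioo (0:ℝ) 1, ∀ y ∈ Ioo (0:ℝ) 1, x ≤ y → P y → P x)
    (x₀ : ℝ) (hx₀ : x₀ ∈ Ioo (0:ℝ) 1) (h₀ : P x₀) : ∀ x ∈ Ioo (0:ℝ) 1, P x := by
  intro x hx
  by_contra hPx
  let S : Set ℝ := {y | y ∈ Ioo (0:ℝ) 1 ∧ P y}
  have hub : ∀ y ∈ S, y ≤ x := by
    intro y hy
    by_contra hlt
    exact hPx (hmono x hx y hy.1 (not_le.1 hlt).le hy.2)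
  have hbdd : BddAbove S := ⟨x, hub⟩
  have hne : S.Nonempty := ⟨x₀, hx₀, h₀⟩
  have hs : sSup S ∈ Ioo (0:ℝ) 1 :=
    ⟨hx₀.1.trans_le (le_csSup hbdd ⟨hx₀, h₀⟩), (csSup_le hne hub).trans_lt hx.2⟩
  obtain ⟨a, b, ha, hb⟩ := hH2 _ hs
  obtain ⟨y, hy, hay⟩ := exists_lt_of_lt_csSup hne ha
  have hPs : P (sSup S) := hpre _ hs a (hmono _ (hH1 a hs) y hy.1 hay.le hy.2)
  exact absurd (le_csSup hbdd ⟨hH1 b hs, him _ hs b hPs⟩) (not_le.2 hb)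

lemma set_all' (f : 𝒜 → ℝ → ℝ) (hH1 : ∀ c, MapsTo (f c) (Ioo (0:ℝ) 1) (Ioo (0:ℝ) 1))
    (hH2 : ∀ x ∈ Ioo (0:ℝ) 1, ∃ a b : 𝒜, f a x < x ∧ x < f b x)
    (P : ℝ → Prop) (hpre : ∀ x ∈ Ioo (0:ℝ) 1, ∀ a, P (f a x) → P x)
    (him : ∀ x ∈ Ioo (0:ℝ) 1, ∀ a, P x → P (f a x))
    (hmono : ∀ x ∈ Ioo (0:ℝ) 1, ∀ y ∈ Ioo (0:ℝ) 1, x ≤ y → P x → P y)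
    (x₀ : ℝ) (hx₀ : x₀ ∈ Ioo (0:ℝ) 1) (h₀ : P x₀) : ∀ x ∈ Ioo (0:ℝ) 1, P x := by
  intro x hx
  by_contra hPx
  let S : Set ℝ := {y | y ∈ Ioo (0:ℝ) 1 ∧ P y}
  have hub : ∀ y ∈ S, x ≤ y := by
    intro y hy
    by_contra hlt
    exact hPx (hmono y hy.1 x hx (not_le.1 hlt).le hy.2)
  have hbdd : BddBelow S := ⟨x, hub⟩
  have hne : S.Nonempty := ⟨x₀, hx₀, h₀⟩
  have hs : sInf S ∈ Ioo (0:ℝ) 1 :=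
    ⟨hx.1.trans_le (le_csInf hne hub), (csInf_le hbdd ⟨hx₀, h₀⟩).trans_lt hx₀.2⟩
  obtain ⟨a, b, ha, hb⟩ := hH2 _ hs
  obtain ⟨y, hy, hay⟩ := exists_lt_of_csInf_lt hne hb
  have hPs : P (sInf S) := hpre _ hs b (hmono y hy.1 _ (hH1 b hs) hay.le hy.2)
  exact absurd (csInf_le hbdd ⟨hH1 a hs, him _ hs a hPs⟩) (not_le.2 ha)

end main

lemma avg_bdd (X : ℕ → ℝ) (hX : ∀ j, X j ∈ Ioo (0:ℝ) 1) (n : ℕ) :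
    0 ≤ (n:ℝ)⁻¹ * ∑ j ∈ Finset.range n, X j ∧ (n:ℝ)⁻¹ * ∑ j ∈ Finset.range n, X j ≤ 1 := by
  constructor
  · exact mul_nonneg (by positivity) (Finset.sum_nonneg fun j _ => (hX j).1.le)
  · have h : ∑ j ∈ Finset.range n, X j ≤ n := by
      calc ∑ j ∈ Finset.range n, X j ≤ ∑ j ∈ Finset.range n, (1 : ℝ) :=
            Finset.sum_le_sum fun j _ => (hX j).2.le
        _ = n := by simp
    rw [inv_mul_eq_div]
    exact div_le_one_of_le₀ h (by positivity)

lemma fin0 (X : ℕ → ℝ) (hX : ∀ j, X j ∈ Ioo (0:ℝ) 1) (γ : ℝ) (hγ : γ ∈ Ioo (0:ℝ) 1)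
    (h : Lf 1 (fun j => (Icc (0:ℝ) γ).indicator 1 (X j))) :
    Filter.liminf (fun n : ℕ => (n:ℝ)⁻¹ * ∑ j ∈ Finset.range n, X j) atTop ≤ γ := by
  refine le_of_forall_gt_imp_ge_of_dense fun b hb => ?_
  have h1γ : 0 < 1 - γ := sub_pos.2 hγ.2
  obtain ⟨q, hq, hq1⟩ := exists_rat_btwn (show (1 - b) / (1 - γ) < 1 by
    rw [div_lt_one h1γ]; linarith)
  rw [div_lt_iff₀ h1γ] at hq
  refine liminf_le_of_frequently_le (frequently_atTop.2 fun N => ?_)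
    ⟨0, eventually_map.2 (Eventually.of_forall fun n => (avg_bdd X hX n).1)⟩
  obtain ⟨n, hn, hlt⟩ := h q hq1 (N + 1)
  refine ⟨n, by omega, ?_⟩
  have hn0 : (0 : ℝ) < n := by
    have : 0 < n := by omega
    exact_mod_cast this
  have hs : ∑ j ∈ Finset.range n, X j ≤
      ∑ j ∈ Finset.range n, (1 - (1 - γ) * (Icc (0:ℝ) γ).indicator 1 (X j)) := by
    refine Finset.sum_le_sum fun j _ => ?_
    by_cases hj : X j ∈ Icc (0:ℝ) γ
    · rw [Set.indicator_of_mem hj]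
      simpa using hj.2
    · rw [Set.indicator_of_notMem hj]
      simpa using (hX j).2.le
  rw [Finset.sum_sub_distrib, ← Finset.mul_sum] at hs
  simp only [Finset.sum_const, Finset.card_range, nsmul_eq_mul, mul_one] at hs
  rw [inv_mul_eq_div, div_le_iff₀ hn0]
  nlinarith [mul_lt_mul_of_pos_left hlt h1γ, mul_lt_mul_of_pos_right hq hn0]

lemma fin1 (X : ℕ → ℝ) (hX : ∀ j, X j ∈ Ioo (0:ℝ) 1) (γ : ℝ) (hγ : γ ∈ Ioo (0:ℝ) 1)
    (h : Lf 1 (fun j => (Icc γ (1:ℝ)).indicator 1 (X j))) :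
    γ ≤ Filter.limsup (fun n : ℕ => (n:ℝ)⁻¹ * ∑ j ∈ Finset.range n, X j) atTop := by
  refine le_of_forall_lt_imp_le_of_dense fun b hb => ?_
  obtain ⟨q, hq, hq1⟩ := exists_rat_btwn (show b / γ < 1 by
    rw [div_lt_one hγ.1]; linarith)
  rw [div_lt_iff₀ hγ.1] at hq
  refine le_limsup_of_frequently_le (frequently_atTop.2 fun N => ?_)
    ⟨1, eventually_map.2 (Eventually.of_forall fun n => (avg_bdd X hX n).2)⟩
  obtain ⟨n, hn, hlt⟩ := h q hq1 (N + 1)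
  refine ⟨n, by omega, ?_⟩
  have hn0 : (0 : ℝ) < n := by
    have : 0 < n := by omega
    exact_mod_cast this
  have hs : ∑ j ∈ Finset.range n, γ * (Icc γ (1:ℝ)).indicator 1 (X j) ≤
      ∑ j ∈ Finset.range n, X j := by
    refine Finset.sum_le_sum fun j _ => ?_
    by_cases hj : X j ∈ Icc γ (1:ℝ)
    · rw [Set.indicator_of_mem hj]
      simpa using hj.1
    · rw [Set.indicator_of_notMem hj]
      simpa using (hX j).1.le
  rw [← Finset.mul_sum] at hs
  rw [inv_mul_eq_div, le_div_iff₀ hn0]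
  nlinarith [mul_lt_mul_of_pos_left hlt hγ.1, mul_lt_mul_of_pos_right hq hn0]

theorem statement0 {𝒜 : Type*} [Countable 𝒜] [MeasurableSpace 𝒜] [MeasurableSingletonClass 𝒜]
    (p : Measure 𝒜) [IsProbabilityMeasure p] (hp : ∀ c : 𝒜, 0 < p {c})
    (ℙ : Measure (ℕ → 𝒜)) [IsProbabilityMeasure ℙ] (hPr : IsBernoulli p ℙ)
    (f : 𝒜 → ℝ → ℝ) (hfm : ∀ c, Measurable (f c))
    (hfI : ∀ c, MapsTo (f c) (Icc (0:ℝ) 1) (Icc (0:ℝ) 1))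
    (hH0 : ∀ x ∈ Ioo (0:ℝ) 1, TailTrivial ℙ fun n ω => fib f ω n x)
    (hH1 : ∀ c, MapsTo (f c) (Ioo (0:ℝ) 1) (Ioo (0:ℝ) 1) ∧ MonotoneOn (f c) (Ioo (0:ℝ) 1))
    (hH2 : ∀ x ∈ Ioo (0:ℝ) 1, ∃ a b : 𝒜, f a x < x ∧ x < f b x)
    (γ₀ γ₁ : ℝ) (hγ₀ : γ₀ ∈ Ioo (0:ℝ) 1) (hγ₁ : γ₁ ∈ Ioo (0:ℝ) 1) (hγ : γ₀ < γ₁)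
    (x₀ x₁ : ℝ) (hx₀ : x₀ ∈ Ioo (0:ℝ) 1) (hx₁ : x₁ ∈ Ioo (0:ℝ) 1)
    (hFL0 : ∀ α ∈ Ioo (0:ℝ) 1,
      Filter.liminf (fun n : ℕ => ℙ {ω | (n:ℝ)⁻¹ *
        ∑ j ∈ Finset.range n, (Icc (0:ℝ) γ₀).indicator 1 (fib f ω j x₀) ≤ α}) atTop < 1)
    (hFL1 : ∀ α ∈ Ioo (0:ℝ) 1,
      Filter.liminf (fun n : ℕ => ℙ {ω | (n:ℝ)⁻¹ *
        ∑ j ∈ Finset.range n, (Icc γ₁ (1:ℝ)).indicator 1 (fib f ω j x₁) ≤ α}) atTop < 1) :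
    ∀ x ∈ Ioo (0:ℝ) 1, ∀ᵐ ω ∂ℙ,
      Filter.liminf (fun n : ℕ => (n:ℝ)⁻¹ * ∑ j ∈ Finset.range n, fib f ω j x) atTop ≤ γ₀ ∧
      γ₁ ≤ Filter.limsup (fun n : ℕ => (n:ℝ)⁻¹ * ∑ j ∈ Finset.range n, fib f ω j x) atTop ∧
      ¬ ∃ c : ℝ, Tendsto (fun n : ℕ => (n:ℝ)⁻¹ * ∑ j ∈ Finset.range n, fib f ω j x)
        atTop (nhds c) := by
  intro x hx
  have hm1 : ∀ c, MapsTo (f c) (Ioo (0:ℝ) 1) (Ioo (0:ℝ) 1) := fun c => (hH1 c).1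
  have hJ0 : MeasurableSet (Icc (0:ℝ) γ₀) := measurableSet_Icc
  have hJ1 : MeasurableSet (Icc γ₁ (1:ℝ)) := measurableSet_Icc
  have full : ∀ {A B : Set (ℕ → 𝒜)}, A ⊆ B → ℙ A = 1 → ℙ B = 1 := fun hAB hA =>
    le_antisymm prob_le_one (hA.ge.trans (measure_mono hAB))
  have e0 : ℙ (Ev f (Icc (0:ℝ) γ₀) 1 x) = 1 := by
    refine set_all f hm1 hH2 (fun y => ℙ (Ev f (Icc (0:ℝ) γ₀) 1 y) = 1)
      (fun y hy a => Ev_pre p hp ℙ hPr f hfm hH0 _ hJ0 1 y hy a)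
      (fun y hy a => Ev_im p hp ℙ hPr f hfm _ hJ0 1 y a) ?_ x₀ hx₀
      (Ev_start ℙ f hfm hH0 _ hJ0 x₀ hx₀ hFL0) x hx
    intro y hy z hz hyz
    refine full fun ω hω => Lf_mono 1 _ _ (fun j => ?_) hω
    have hj := fib_mono f hH1 ω j y z hy hz hyz
    by_cases hm : fib f ω j z ∈ Icc (0:ℝ) γ₀
    · rw [Set.indicator_of_mem hm, Set.indicator_of_mem
        (show fib f ω j y ∈ Icc (0:ℝ) γ₀ from ⟨(fib_mem f hH1 ω j y hy).1.le, hj.trans hm.2⟩)]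
      rfl
    · rw [Set.indicator_of_notMem hm]
      exact ind_nonneg _ _
  have e1 : ℙ (Ev f (Icc γ₁ (1:ℝ)) 1 x) = 1 := by
    refine set_all' f hm1 hH2 (fun y => ℙ (Ev f (Icc γ₁ (1:ℝ)) 1 y) = 1)
      (fun y hy a => Ev_pre p hp ℙ hPr f hfm hH0 _ hJ1 1 y hy a)
      (fun y hy a => Ev_im p hp ℙ hPr f hfm _ hJ1 1 y a) ?_ x₁ hx₁
      (Ev_start ℙ f hfm hH0 _ hJ1 x₁ hx₁ hFL1) x hx
    intro y hy z hz hyz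
    refine full fun ω hω => Lf_mono 1 _ _ (fun j => ?_) hω
    have hj := fib_mono f hH1 ω j y z hy hz hyz
    by_cases hm : fib f ω j y ∈ Icc γ₁ (1:ℝ)
    · rw [Set.indicator_of_mem hm, Set.indicator_of_mem
        (show fib f ω j z ∈ Icc γ₁ (1:ℝ) from ⟨hm.1.trans hj, (fib_mem f hH1 ω j z hz).2.le⟩)]
      rfl
    · rw [Set.indicator_of_notMem hm]
      exact ind_nonneg _ _
  have a0 : ∀ᵐ ω ∂ℙ, ω ∈ Ev f (Icc (0:ℝ) γ₀) 1 x :=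
    (prob_compl_eq_zero_iff (Ev_meas f hfm _ hJ0 1 x)).2 e0
  have a1 : ∀ᵐ ω ∂ℙ, ω ∈ Ev f (Icc γ₁ (1:ℝ)) 1 x :=
    (prob_compl_eq_zero_iff (Ev_meas f hfm _ hJ1 1 x)).2 e1
  filter_upwards [a0, a1] with ω h0 h1
  have hX : ∀ j, fib f ω j x ∈ Ioo (0:ℝ) 1 := fun j => fib_mem f hH1 ω j x hx
  have r0 := fin0 (fun j => fib f ω j x) hX γ₀ hγ₀ h0
  have r1 := fin1 (fun j => fib f ω j x) hX γ₁ hγ₁ h1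
  refine ⟨r0, r1, ?_⟩
  rintro ⟨c, hc⟩
  have l0 := hc.liminf_eq
  have l1 := hc.limsup_eq
  rw [l0] at r0
  rw [l1] at r1
  linarith
end
end

section
/- For every x ∈ (0,1), for ℙ-almost every ω ∈ Ω: liminf_{n→∞} (1/n)∑_{j=0}^{n-1} f_ω^j(x) = 0 and limsup_{n→∞} (1/n)∑_{j=0}^{n-1} f_ω^j(x) = 1; in particular, the Birkhoff averages (1/n)∑_{j=0}^{n-1} f_ω^j(x) fail to converge for ℙ-almost every ω. -/
open MeasureTheory Filter Set

noncomputable section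

/-- Most of the terms of `s` with index in `[m, k m)` are above any given level, for infinitely
many `m`. -/
def Ev19 (k : ℕ) (s : ℕ → ℝ) : Prop :=
  ∀ K : ℕ, ∃ᶠ m : ℕ in atTop,
    ((Finset.Ico m (k * m)).filter (fun j => s j ≤ (K : ℝ))).card ≤ m

lemma Ev19.shift {k : ℕ} {s t : ℕ → ℝ} (h : Ev19 k s) (r : ℕ) (c : ℝ)
    (hst : ∀ j, r ≤ j → s j = t j + c) : Ev19 k t := by
  intro K
  obtain ⟨L, hL⟩ := exists_nat_ge ((K : ℝ) + c)
  refine ((h L).and_eventually (eventually_ge_atTop r)).mono ?_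
  rintro m ⟨hm, hr⟩
  refine le_trans (Finset.card_le_card ?_) hm
  intro j hj
  simp only [Finset.mem_filter, Finset.mem_Ico] at hj ⊢
  refine ⟨hj.1, ?_⟩
  rw [hst j (by omega)]
  linarith [hj.2]

lemma avg_freq19 {u : ℕ → ℝ} (hu0 : ∀ j, 0 ≤ u j)
    (h : ∀ k : ℕ, ∀ η < (1:ℝ), ∃ᶠ m : ℕ in atTop,
      ((Finset.Ico m (k * m)).filter (fun j => u j ≤ η)).card ≤ m) (ε : ℝ) (hε : 0 < ε) :
    ∃ᶠ n : ℕ in atTop, 1 - ε ≤ (n:ℝ)⁻¹ * ∑ j ∈ Finset.range n, u j := by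
  wlog hε1 : ε < 1 generalizing ε
  · refine (this (1/2) (by norm_num) (by norm_num)).mono fun n hn => le_trans ?_ hn
    linarith
  obtain ⟨k, hk⟩ := exists_nat_gt (4 / ε)
  have hk4 : (4:ℝ) < k := lt_of_le_of_lt (by rw [le_div_iff₀ hε]; linarith) hk
  have hk' : 4 < ε * k := by rw [div_lt_iff₀ hε] at hk; linarith
  have hkn : 4 < k := by exact_mod_cast hk4
  rw [frequently_atTop]
  intro N
  obtain ⟨m, hm, hc⟩ := frequently_atTop.1 (h k (1 - ε / 2) (by linarith)) (N + 1)
  refine ⟨k * m, by nlinarith, ?_⟩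
  have hm0 : (0:ℝ) < m := by exact_mod_cast (by omega : 0 < m)
  push_cast
  rw [inv_mul_eq_div, le_div_iff₀ (by positivity)]
  have h1 : ∑ j ∈ (Finset.Ico m (k * m)).filter (fun j => ¬ u j ≤ 1 - ε / 2), u j
      ≤ ∑ j ∈ Finset.range (k * m), u j := by
    refine Finset.sum_le_sum_of_subset_of_nonneg ?_ fun j _ _ => hu0 j
    intro j hj
    simp only [Finset.mem_filter, Finset.mem_Ico, Finset.mem_range] at hj ⊢
    exact hj.1.2
  have h2 : (((Finset.Ico m (k * m)).filter (fun j => ¬ u j ≤ 1 - ε / 2)).card : ℝ) * (1 - ε / 2)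
      ≤ ∑ j ∈ (Finset.Ico m (k * m)).filter (fun j => ¬ u j ≤ 1 - ε / 2), u j := by
    rw [← nsmul_eq_mul]
    refine Finset.card_nsmul_le_sum _ _ _ fun j hj => ?_
    simp only [Finset.mem_filter] at hj
    linarith [hj.2]
  have h3 := Finset.card_filter_add_card_filter_not (s := Finset.Ico m (k * m))
    (fun j => u j ≤ 1 - ε / 2)
  rw [Nat.card_Ico] at h3
  have h4 : k * m ≤ ((Finset.Ico m (k * m)).filter (fun j => ¬ u j ≤ 1 - ε / 2)).card + 2 * m := by
    omega
  have h5 : (k:ℝ) * m ≤ ((Finset.Ico m (k * m)).filter (fun j => ¬ u j ≤ 1 - ε / 2)).card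
      + 2 * m := by exact_mod_cast h4
  nlinarith

lemma logistic_freq19 {s : ℕ → ℝ} (hs : ∀ k, Ev19 k s) (r : ℝ) (hr : 0 < r) (ε : ℝ) (hε : 0 < ε) :
    ∃ᶠ n : ℕ in atTop, 1 - ε ≤ (n:ℝ)⁻¹ * ∑ j ∈ Finset.range n,
      (r * Real.exp (s j) / (1 + r * Real.exp (s j))) := by
  refine avg_freq19 (fun j => by positivity) ?_ ε hε
  intro k η hη
  obtain ⟨K, hK⟩ := exists_nat_ge (((1 - η)⁻¹ / r))
  refine (hs k K).mono fun m hm => le_trans (Finset.card_le_card ?_) hm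
  intro j hj
  simp only [Finset.mem_filter] at hj ⊢
  refine ⟨hj.1, ?_⟩
  have h1 := hj.2
  have hpos : 0 < r * Real.exp (s j) := by positivity
  have hη' : 0 < 1 - η := by linarith
  have h2 : 1 + r * Real.exp (s j) ≤ (1 - η)⁻¹ := by
    rw [div_le_iff₀ (by positivity)] at h1
    rw [← one_div, le_div_iff₀ hη']
    linarith
  have h3 : Real.exp (s j) ≤ K := by
    refine le_trans ?_ hK
    rw [le_div_iff₀ hr]; linarith
  linarith [Real.add_one_le_exp (s j)]

lemma fib_eq19 {𝒜 : Type*} (a : 𝒜 → ℝ) (ha : ∀ c, 0 < a c) (x : ℝ) (hx : x ∈ Ioo (0:ℝ) 1)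
    (ω : ℕ → 𝒜) (n : ℕ) :
    fib (fun c y => a c * y / (1 + (a c - 1) * y)) ω n x =
      (x / (1 - x)) * Real.exp (∑ i ∈ Finset.range n, Real.log (a (ω i))) /
        (1 + (x / (1 - x)) * Real.exp (∑ i ∈ Finset.range n, Real.log (a (ω i)))) := by
  have hx1 : 0 < 1 - x := by linarith [hx.2]
  have hx0 := hx.1
  induction n with
  | zero => simp [fib]; field_simp; ring
  | succ n ih =>
    simp only [fib, Function.comp_apply, ih]
    rw [Finset.sum_range_succ, Real.exp_add, Real.exp_log (ha _)]
    have hA := ha (ω n)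
    generalize a (ω n) = A at *
    have hR : 0 < (x / (1 - x)) * Real.exp (∑ i ∈ Finset.range n, Real.log (a (ω i))) := by
      positivity
    rw [← mul_assoc]
    generalize (x / (1 - x)) * Real.exp (∑ i ∈ Finset.range n, Real.log (a (ω i))) = R at *
    have e : 1 + (A - 1) * (R / (1 + R)) = (1 + R * A) / (1 + R) := by field_simp; ring
    rw [e]
    field_simp

/-- The deterministic part. -/
lemma final19 {u s : ℕ → ℝ} {r : ℝ} (hr : 0 < r)
    (hu : ∀ j, u j = r * Real.exp (s j) / (1 + r * Real.exp (s j)))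
    (h1 : ∀ k, Ev19 k s) (h2 : ∀ k, Ev19 k (fun j => - s j)) :
    Filter.liminf (fun n : ℕ => (n:ℝ)⁻¹ * ∑ j ∈ Finset.range n, u j) atTop = 0 ∧
    Filter.limsup (fun n : ℕ => (n:ℝ)⁻¹ * ∑ j ∈ Finset.range n, u j) atTop = 1 ∧
    ¬ ∃ L : ℝ, Tendsto (fun n : ℕ => (n:ℝ)⁻¹ * ∑ j ∈ Finset.range n, u j) atTop (nhds L) := by
  set v : ℕ → ℝ := fun n : ℕ => (n:ℝ)⁻¹ * ∑ j ∈ Finset.range n, u j with hv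
  have hu0 : ∀ j, 0 ≤ u j := fun j => by rw [hu]; positivity
  have hu1 : ∀ j, u j ≤ 1 := fun j => by
    rw [hu, div_le_one (by positivity)]; linarith
  have hv0 : ∀ n, 0 ≤ v n := fun n => mul_nonneg (by positivity) (Finset.sum_nonneg fun j _ => hu0 j)
  have hv1 : ∀ n, v n ≤ 1 := fun n => by
    have : ∑ j ∈ Finset.range n, u j ≤ n := by
      simpa using Finset.sum_le_card_nsmul (Finset.range n) u 1 fun j _ => hu1 j
    rw [hv]; simp only
    rw [inv_mul_eq_div]
    exact div_le_one_of_le₀ this (by positivity)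
  have f1 : ∀ ε > 0, ∃ᶠ n in atTop, 1 - ε ≤ v n := fun ε hε => by
    simpa only [hv, hu] using logistic_freq19 h1 r hr ε hε
  have f2 : ∀ ε > 0, ∃ᶠ n in atTop, v n ≤ ε := fun ε hε => by
    refine ((logistic_freq19 h2 r⁻¹ (by positivity) ε hε).and_eventually
      (eventually_gt_atTop 0)).mono ?_
    rintro n ⟨hn, hn0⟩
    have e : ∀ j, r⁻¹ * Real.exp (- s j) / (1 + r⁻¹ * Real.exp (- s j)) = 1 - u j := fun j => by
      rw [hu, Real.exp_neg]
      have := Real.exp_pos (s j)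
      field_simp
      ring
    have hn' : (n:ℝ) ≠ 0 := by positivity
    simp only [e, Finset.sum_sub_distrib, mul_sub] at hn
    simp [hn'] at hn
    simp only [hv]
    linarith
  have hba : IsBoundedUnder (· ≤ ·) atTop v := isBoundedUnder_of ⟨1, hv1⟩
  have hbb : IsBoundedUnder (· ≥ ·) atTop v := isBoundedUnder_of ⟨0, hv0⟩
  have L0 : liminf v atTop = 0 := by
    refine le_antisymm (le_of_forall_pos_le_add fun ε hε => ?_) ?_
    · rw [zero_add]; exact liminf_le_of_frequently_le (f2 ε hε) hbb
    · exact le_liminf_of_le hba.isCoboundedUnder_ge (Eventually.of_forall hv0)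
  have L1 : limsup v atTop = 1 := by
    refine le_antisymm ?_ (le_of_forall_pos_le_add fun ε hε => ?_)
    · exact limsup_le_of_le hbb.isCoboundedUnder_le (Eventually.of_forall hv1)
    · linarith [le_limsup_of_frequently_le (f1 ε hε) hba]
  refine ⟨L0, L1, ?_⟩
  rintro ⟨L, hL⟩
  have := hL.liminf_eq
  have := hL.limsup_eq
  linarith

section prob19
open ProbabilityTheory
open scoped Topology

variable {Ω : Type*} [mΩ : MeasurableSpace Ω] {μ : Measure Ω} [IsProbabilityMeasure μ]

lemma measure_freq19 {G : ℕ → Set Ω} (hG : ∀ n, MeasurableSet (G n)) {δ : ENNReal}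
    (h : ∀ᶠ n in atTop, δ ≤ μ (G n)) : δ ≤ μ {ω | ∃ᶠ n in atTop, ω ∈ G n} := by
  have e : {ω | ∃ᶠ n in atTop, ω ∈ G n} = ⋂ N : ℕ, ⋃ n ≥ N, G n := by
    ext ω; simp [frequently_atTop]
  rw [e]
  have ht := tendsto_measure_iInter_atTop (μ := μ) (s := fun N : ℕ => ⋃ n ≥ N, G n)
    (fun N => (MeasurableSet.iUnion fun n => MeasurableSet.iUnion fun _ => hG n).nullMeasurableSet)
    (by
      intro a b hab
      refine iUnion_mono fun n => ?_
      exact iUnion_mono' fun hn => ⟨le_trans hab hn, le_rfl⟩)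
    ⟨0, measure_ne_top _ _⟩
  refine ge_of_tendsto' ht fun N => ?_
  obtain ⟨n, hn, hn2⟩ := (h.and (eventually_ge_atTop N)).exists
  exact hn.trans (measure_mono (subset_biUnion_of_mem (u := G) (show n ∈ {n | n ≥ N} from hn2)))

lemma clt_pos19 {X : ℕ → Ω → ℝ} (hindep : iIndepFun X μ)
    (hid : ∀ i, IdentDistrib (X i) (X 0) μ μ) (hL2 : MemLp (X 0) 2 μ) (h0 : μ[X 0] = 0)
    (hvar : Var[X 0; μ] ≠ 0) (t : ℝ) :
    ∃ δ : ENNReal, 0 < δ ∧ ∀ᶠ n : ℕ in atTop,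
      δ ≤ μ {ω | t * √n < ∑ k ∈ Finset.range n, X k ω} := by
  set v := Var[X 0; μ].toNNReal with hv
  have hv0 : v ≠ 0 := by
    rw [hv, Ne, Real.toNNReal_eq_zero, not_le]
    exact lt_of_le_of_ne (variance_nonneg _ _) hvar.symm
  have hclt := tendstoInDistribution_inv_sqrt_mul_sum_sub (P := μ) (P' := gaussianReal 0 v)
    (Y := id) (X := X) HasLaw.id hL2 hindep hid
  have hpos : 0 < gaussianReal 0 v (Ioi t) := by
    rw [pos_iff_ne_zero]
    intro hz
    have := gaussianReal_absolutelyContinuous' 0 hv0 hz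
    simp at this
  have hlim := ProbabilityMeasure.le_liminf_measure_open_of_tendsto hclt.tendsto (isOpen_Ioi (a := t))
  obtain ⟨δ, hδ0, hδ⟩ := exists_between hpos
  refine ⟨δ, hδ0, ?_⟩
  have hlt : δ < liminf (fun n : ℕ => (μ.map (fun ω =>
      (√n)⁻¹ * (∑ k ∈ Finset.range n, X k ω - n * μ[X 0]))) (Ioi t)) atTop := by
    refine lt_of_lt_of_le hδ (le_trans (le_of_eq ?_) hlim)
    simp
  filter_upwards [eventually_lt_of_lt_liminf hlt, eventually_gt_atTop 0] with n hn hn0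
  refine hn.le.trans ?_
  rw [Measure.map_apply_of_aemeasurable (hclt.forall_aemeasurable n) measurableSet_Ioi]
  refine measure_mono fun ω hω => ?_
  simp only [mem_preimage, mem_Ioi, h0, mul_zero, sub_zero, mem_setOf_eq] at hω ⊢
  have : 0 < √(n:ℝ) := Real.sqrt_pos.2 (by exact_mod_cast hn0)
  rw [inv_mul_eq_div, lt_div_iff₀ this] at hω
  exact hω

lemma second_moment19 {X : ℕ → Ω → ℝ} (hindep : iIndepFun X μ)
    (hid : ∀ i, IdentDistrib (X i) (X 0) μ μ) (hL2 : MemLp (X 0) 2 μ) (h0 : μ[X 0] = 0)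
    (m j : ℕ) :
    Integrable (fun ω => (∑ i ∈ Finset.Ico m j, X i ω) ^ 2) μ ∧
    ∫ ω, (∑ i ∈ Finset.Ico m j, X i ω) ^ 2 ∂μ ≤ j * Var[X 0; μ] := by
  have hL : ∀ i, MemLp (X i) 2 μ := fun i => (hid i).memLp_iff.2 hL2
  have hS : MemLp (∑ i ∈ Finset.Ico m j, X i) 2 μ := memLp_finset_sum' _ fun i _ => hL i
  have hi : ∀ i, Integrable (X i) μ := fun i => (hL i).integrable (by norm_num)
  have hz : μ[∑ i ∈ Finset.Ico m j, X i] = 0 := by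
    simp only [Finset.sum_apply]
    rw [integral_finset_sum _ fun i _ => hi i]
    refine Finset.sum_eq_zero fun i _ => ?_
    rw [(hid i).integral_eq, h0]
  have hV := IndepFun.variance_sum (μ := μ) (X := X) (s := Finset.Ico m j) (fun i _ => hL i)
    (fun a _ b _ hab => hindep.indepFun hab)
  rw [variance_of_integral_eq_zero hS.aestronglyMeasurable.aemeasurable hz] at hV
  simp only [Finset.sum_apply] at hV
  constructor
  · simpa using hS.integrable_sq
  · have e : ∀ i, Var[X i; μ] = Var[X 0; μ] := fun i => (hid i).variance_eq
    simp only [e, Finset.sum_const, Nat.card_Ico, nsmul_eq_mul] at hV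
    refine le_trans (le_of_eq (by simpa using hV)) ?_
    refine mul_le_mul_of_nonneg_right ?_ (variance_nonneg _ _)
    exact_mod_cast Nat.sub_le _ _

lemma B_half19 {X : ℕ → Ω → ℝ} (hindep : iIndepFun X μ) 
    (hid : ∀ i, IdentDistrib (X i) (X 0) μ μ) (hL2 : MemLp (X 0) 2 μ) (h0 : μ[X 0] = 0)
    (k m : ℕ) (hm : 0 < m) (C : ℝ) (hC0 : 0 < C) (hC : 2 * (k ^ 2 * Var[X 0; μ]) ≤ C) :
    (1/2 : ENNReal) ≤ μ {ω | ∑ j ∈ Finset.Ico m (k * m), (∑ i ∈ Finset.Ico m j, X i ω) ^ 2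
      < C * m ^ 2} := by
  have hs := second_moment19 hindep hid hL2 h0 m
  set Z : Ω → ℝ := fun ω => ∑ j ∈ Finset.Ico m (k * m), (∑ i ∈ Finset.Ico m j, X i ω) ^ 2 with hZ
  have hZi : Integrable Z μ := integrable_finset_sum _ fun j _ => (hs j).1
  have hV := variance_nonneg (X 0) μ
  have hZe : ∫ ω, Z ω ∂μ ≤ k ^ 2 * Var[X 0; μ] * m ^ 2 := by
    rw [hZ, integral_finset_sum _ fun j _ => (hs j).1]
    calc _ ≤ ∑ j ∈ Finset.Ico m (k * m), (k * m : ℝ) * Var[X 0; μ] := by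
          refine Finset.sum_le_sum fun j hj => (hs j).2.trans ?_
          refine mul_le_mul_of_nonneg_right ?_ hV
          exact_mod_cast (Finset.mem_Ico.1 hj).2.le
      _ = ((k * m - m : ℕ) : ℝ) * ((k * m : ℝ) * Var[X 0; μ]) := by simp
      _ ≤ (k * m : ℝ) * ((k * m : ℝ) * Var[X 0; μ]) := by
          refine mul_le_mul_of_nonneg_right ?_ (by positivity)
          exact_mod_cast Nat.sub_le _ _
      _ = _ := by ring
  have hmk := mul_meas_ge_le_integral_of_nonneg (μ := μ) (f := Z)
    (ae_of_all _ fun ω => Finset.sum_nonneg fun j _ => sq_nonneg _) hZi (C * m ^ 2)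
  have hm' : (0:ℝ) < m := by exact_mod_cast hm
  have hhalf : μ.real {ω | C * m ^ 2 ≤ Z ω} ≤ 1 / 2 := by
    have : 0 < C * (m:ℝ) ^ 2 := by positivity
    by_contra hcon
    push Not at hcon
    have h2 : C * (m:ℝ) ^ 2 * (1/2) < C * m ^ 2 * μ.real {ω | C * m ^ 2 ≤ Z ω} :=
      mul_lt_mul_of_pos_left hcon this
    nlinarith [sq_nonneg (m:ℝ)]
  have hnull : NullMeasurableSet {ω | C * m ^ 2 ≤ Z ω} μ :=
    nullMeasurableSet_le aemeasurable_const hZi.aestronglyMeasurable.aemeasurable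
  have hcompl : {ω | Z ω < C * m ^ 2} = {ω | C * m ^ 2 ≤ Z ω}ᶜ := by ext; simp
  have hr : μ.real {ω | Z ω < C * m ^ 2} = 1 - μ.real {ω | C * m ^ 2 ≤ Z ω} := by
    rw [hcompl, measureReal_compl₀ hnull]; simp
  change _ ≤ μ {ω | Z ω < C * m ^ 2}
  rw [← ofReal_measureReal]
  rw [show (1/2 : ENNReal) = ENNReal.ofReal (1/2) by
    rw [ENNReal.ofReal_div_of_pos (by norm_num)]; simp]
  exact ENNReal.ofReal_le_ofReal (by linarith)

lemma meas_sum19 (X : ℕ → Ω → ℝ) (S : Set ℕ) (s : Finset ℕ) (hs : ∀ i ∈ s, i ∈ S) :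
    Measurable[⨆ i ∈ S, MeasurableSpace.comap (X i) inferInstance]
      (fun ω => ∑ i ∈ s, X i ω) := by
  refine Finset.measurable_fun_sum s fun i hi => ?_
  refine Measurable.mono (comap_measurable (X i)) ?_ le_rfl
  exact le_iSup₂_of_le (f := fun i (_ : i ∈ S) => MeasurableSpace.comap (X i) inferInstance)
    i (hs i hi) le_rfl

lemma Ev_meas19 {m' : MeasurableSpace Ω} {k : ℕ} {s : ℕ → Ω → ℝ} (hs : ∀ j, Measurable[m'] (s j)) :
    MeasurableSet[m'] {ω | Ev19 k (fun j => s j ω)} := by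
  have e : {ω | Ev19 k (fun j => s j ω)} = ⋂ K : ℕ, ⋂ N : ℕ, ⋃ m : ℕ, ⋃ (_ : N ≤ m),
      {ω | ∑ j ∈ Finset.Ico m (k * m), (if s j ω ≤ (K:ℝ) then 1 else 0) ≤ m} := by
    ext ω
    simp only [Ev19, frequently_atTop, Finset.card_filter, mem_setOf_eq, mem_iInter, mem_iUnion,
      exists_prop, ge_iff_le]
  rw [e]
  refine MeasurableSet.iInter fun K => MeasurableSet.iInter fun N => MeasurableSet.iUnion fun m =>
    MeasurableSet.iUnion fun _ => ?_
  refine measurableSet_le (Finset.measurable_fun_sum _ fun j _ => ?_) measurable_const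
  exact Measurable.ite (measurableSet_le (hs j) measurable_const) measurable_const measurable_const

lemma Ev_ae19 {X : ℕ → Ω → ℝ} (hX : ∀ i, Measurable (X i)) (hindep : iIndepFun X μ)
    (hid : ∀ i, IdentDistrib (X i) (X 0) μ μ) (hL2 : MemLp (X 0) 2 μ) (h0 : μ[X 0] = 0)
    (hvar : Var[X 0; μ] ≠ 0) (k : ℕ) :
    ∀ᵐ ω ∂μ, Ev19 k (fun j => ∑ i ∈ Finset.range j, X i ω) := by
  have hle : ∀ i, MeasurableSpace.comap (X i) inferInstance ≤ mΩ := fun i => (hX i).comap_le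
  have hI : iIndep (fun i => MeasurableSpace.comap (X i) inferInstance) μ := hindep
  set E : Set Ω := {ω | Ev19 k (fun j => ∑ i ∈ Finset.range j, X i ω)} with hE
  have hEm : MeasurableSet E := Ev_meas19 fun j => Finset.measurable_fun_sum _ fun i _ => hX i
  -- tail event
  have htail : MeasurableSet[limsup (fun i => MeasurableSpace.comap (X i) inferInstance) atTop] E := by
    rw [limsup_eq_iInf_iSup_of_nat, MeasurableSpace.measurableSet_iInf]
    intro r
    have e : E = {ω | Ev19 k (fun j => ∑ i ∈ Finset.Ico r j, X i ω)} := by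
      ext ω
      constructor
      · intro h
        refine Ev19.shift h r (∑ i ∈ Finset.range r, X i ω) fun j hj => ?_
        rw [← Finset.sum_range_add_sum_Ico _ hj, add_comm]
      · intro h
        refine Ev19.shift h r (- ∑ i ∈ Finset.range r, X i ω) fun j hj => ?_
        rw [← Finset.sum_range_add_sum_Ico (fun i => X i ω) hj]; ring
    rw [e]
    exact Ev_meas19 fun j => meas_sum19 X {i | i ≥ r} _ fun i hi => (Finset.mem_Ico.1 hi).1
  -- positive probability
  have hv : 0 < Var[X 0; μ] := lt_of_le_of_ne (variance_nonneg _ _) hvar.symm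
  set C : ℝ := 2 * (k ^ 2 * Var[X 0; μ]) + 1 with hC
  have hC0 : 0 < C := by positivity
  obtain ⟨δ, hδ, hA⟩ := clt_pos19 hindep hid hL2 h0 hvar (√C + 1)
  set A : ℕ → Set Ω := fun m => {ω | (√C + 1) * √m < ∑ i ∈ Finset.range m, X i ω}
  set B : ℕ → Set Ω := fun m => {ω | ∑ j ∈ Finset.Ico m (k * m),
    (∑ i ∈ Finset.Ico m j, X i ω) ^ 2 < C * m ^ 2}
  have hAm' : ∀ m, MeasurableSet[⨆ i ∈ Iio m, MeasurableSpace.comap (X i) inferInstance] (A m) := by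
    intro m
    exact measurableSet_lt measurable_const (meas_sum19 X (Iio m) _ fun i hi => Finset.mem_range.1 hi)
  have hBm' : ∀ m, MeasurableSet[⨆ i ∈ Ici m, MeasurableSpace.comap (X i) inferInstance] (B m) := by
    intro m
    refine measurableSet_lt (Finset.measurable_fun_sum _ fun j _ => ?_) measurable_const
    exact (meas_sum19 X (Ici m) _ fun i hi => (Finset.mem_Ico.1 hi).1).pow_const 2
  have hsup : ∀ S : Set ℕ, (⨆ i ∈ S, MeasurableSpace.comap (X i) inferInstance) ≤ mΩ :=
    fun S => iSup₂_le fun i _ => hle i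
  have hAB : ∀ m, μ (A m ∩ B m) = μ (A m) * μ (B m) := by
    intro m
    have := indep_iSup_of_disjoint hle hI (S := Iio m) (T := Ici m)
      (by rw [Set.disjoint_left]; intro i hi hi'; exact absurd (Set.mem_Iio.1 hi) (not_lt.2 (Set.mem_Ici.1 hi')))
    exact (Indep_iff _ _ _).1 this _ _ (hAm' m) (hBm' m)
  have hfreq : δ * (1/2) ≤ μ {ω | ∃ᶠ m in atTop, ω ∈ A m ∩ B m} := by
    refine measure_freq19 (fun m => (hsup _ _ (hAm' m)).inter (hsup _ _ (hBm' m))) ?_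
    filter_upwards [hA, eventually_gt_atTop 0] with m hm hm0
    rw [hAB]
    exact mul_le_mul' hm (B_half19 hindep hid hL2 h0 k m hm0 C hC0 (by linarith))
  have hsub : {ω | ∃ᶠ m in atTop, ω ∈ A m ∩ B m} ⊆ E := by
    intro ω hω K
    obtain ⟨N, hN⟩ := exists_nat_ge ((K:ℝ) ^ 2)
    refine (Frequently.and_eventually hω (eventually_ge_atTop (N + 1))).mono ?_
    rintro m ⟨⟨hmA, hmB⟩, hmN⟩
    simp only [A, B, mem_setOf_eq] at hmA hmB
    have hmN' : (N:ℝ) + 1 ≤ m := by exact_mod_cast hmN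
    have hm0 : (0:ℝ) < m := by linarith [N.cast_nonneg (α := ℝ)]
    have hK : (K:ℝ) ≤ √m := Real.le_sqrt_of_sq_le (by linarith)
    set F := (Finset.Ico m (k * m)).filter (fun j => ∑ i ∈ Finset.range j, X i ω ≤ (K : ℝ)) with hF
    have h1 : (F.card : ℝ) * (C * m) ≤ ∑ j ∈ F, (∑ i ∈ Finset.Ico m j, X i ω) ^ 2 := by
      rw [← nsmul_eq_mul]
      refine Finset.card_nsmul_le_sum _ _ _ fun j hj => ?_
      simp only [hF, Finset.mem_filter, Finset.mem_Ico] at hj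
      have h2 := Finset.sum_range_add_sum_Ico (fun i => X i ω) hj.1.1
      have h3 : √C * √m ≤ - ∑ i ∈ Finset.Ico m j, X i ω := by nlinarith [hj.2]
      have h4 : (√C * √m) ^ 2 ≤ (- ∑ i ∈ Finset.Ico m j, X i ω) ^ 2 :=
        pow_le_pow_left₀ (by positivity) h3 2
      rw [mul_pow, Real.sq_sqrt hC0.le, Real.sq_sqrt hm0.le, neg_sq] at h4
      exact h4
    have h5 : ∑ j ∈ F, (∑ i ∈ Finset.Ico m j, X i ω) ^ 2 ≤
        ∑ j ∈ Finset.Ico m (k * m), (∑ i ∈ Finset.Ico m j, X i ω) ^ 2 :=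
      Finset.sum_le_sum_of_subset_of_nonneg (Finset.filter_subset _ _) fun j _ _ => sq_nonneg _
    have h6 : (F.card : ℝ) * (C * m) < m * (C * m) := by nlinarith
    have h7 : (F.card : ℝ) < m := lt_of_mul_lt_mul_right h6 (by positivity)
    exact_mod_cast h7.le
  rcases measure_zero_or_one_of_measurableSet_limsup_atTop hle hI htail with h | h
  · exfalso
    have := (hfreq.trans (measure_mono hsub)).trans_eq h
    rw [nonpos_iff_eq_zero, mul_eq_zero] at this
    rcases this with h | h
    · exact hδ.ne' h
    · simp at h
  · exact (mem_ae_iff_prob_eq_one hEm).2 h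

lemma bern_eq19 {𝒜 : Type*} [MeasurableSpace 𝒜] (p : Measure 𝒜) [IsProbabilityMeasure p]
    (Pr : Measure (ℕ → 𝒜)) (hPr : IsBernoulli p Pr) :
    Pr = Measure.infinitePi (fun _ : ℕ => p) := by
  classical
  refine Measure.eq_infinitePi _ fun s t ht => ?_
  obtain ⟨n, hn⟩ : ∃ n, s ⊆ Finset.range n := by
    refine ⟨s.sup id + 1, fun i hi => ?_⟩
    have : i ≤ s.sup id := Finset.le_sup (f := id) hi
    simp; omega
  have h := hPr n (fun i => if (i:ℕ) ∈ s then t i else univ)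
    (fun i => by split_ifs; exacts [ht _, MeasurableSet.univ])
  have e : Set.pi (s : Set ℕ) t = {ω : ℕ → 𝒜 | ∀ i : Fin n, ω (i : ℕ) ∈
      (if (i:ℕ) ∈ s then t i else univ)} := by
    ext ω
    simp only [Set.mem_pi, Finset.mem_coe, mem_setOf_eq]
    constructor
    · intro h i
      split_ifs with hi
      · exact h _ hi
      · trivial
    · intro h i hi
      have := h ⟨i, Finset.mem_range.1 (hn hi)⟩
      simpa [hi] using this
  rw [e, h, Fin.prod_univ_eq_prod_range (fun i => p (if i ∈ s then t i else univ)) n,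
    ← Finset.prod_subset hn]
  · exact Finset.prod_congr rfl fun i hi => by simp [hi]
  · intro i _ hi; simp [hi]

lemma bern_Ev19 {𝒜 : Type*} [Countable 𝒜] [MeasurableSpace 𝒜] [MeasurableSingletonClass 𝒜]
    (p : Measure 𝒜) [IsProbabilityMeasure p] (hp : ∀ c : 𝒜, 0 < p {c})
    (Pr : Measure (ℕ → 𝒜)) [IsProbabilityMeasure Pr] (hPr : IsBernoulli p Pr)
    (Y : 𝒜 → ℝ) (hY : ∀ c, Y c ≠ 0) (hint : ∫ c, Y c ∂p = 0)
    (hsq : Integrable (fun c => (Y c) ^ 2) p) :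
    ∀ᵐ ω ∂Pr, ∀ k, Ev19 k (fun j => ∑ i ∈ Finset.range j, Y (ω i)) := by
  rw [ae_all_iff]
  intro k
  have hPe := bern_eq19 p Pr hPr
  have hYm : Measurable Y := measurable_of_countable Y
  have hmp : ∀ i : ℕ, MeasurePreserving (fun ω : ℕ → 𝒜 => ω i) Pr p := fun i =>
    ⟨measurable_pi_apply i, by rw [hPe]; exact Measure.infinitePi_map_eval (fun _ : ℕ => p) i⟩
  have hLp : MemLp Y 2 p := (memLp_two_iff_integrable_sq hYm.aestronglyMeasurable).2 hsq
  have hL2 : MemLp (fun ω : ℕ → 𝒜 => Y (ω 0)) 2 Pr := hLp.comp_measurePreserving (hmp 0)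
  have hm : ∀ i : ℕ, Measurable (fun ω : ℕ → 𝒜 => Y (ω i)) :=
    fun i => hYm.comp (measurable_pi_apply i)
  have h0 : ∫ ω : ℕ → 𝒜, Y (ω 0) ∂Pr = 0 := by
    rw [← hint, ← (hmp 0).map_eq, integral_map (hmp 0).measurable.aemeasurable
      hYm.aestronglyMeasurable]
  have hmap : ∀ i : ℕ, Measure.map (fun ω : ℕ → 𝒜 => Y (ω i)) Pr = Measure.map Y p := fun i => by
    rw [← (hmp i).map_eq, Measure.map_map hYm (hmp i).measurable]; rfl
  refine Ev_ae19 (X := fun i (ω : ℕ → 𝒜) => Y (ω i)) hm ?_ ?_ hL2 h0 ?_ k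
  · rw [hPe]; exact iIndepFun_infinitePi (X := fun _ => Y) fun _ => hYm
  · exact fun i => ⟨(hm i).aemeasurable, (hm 0).aemeasurable, by rw [hmap, hmap]⟩
  · intro hv
    rw [variance_of_integral_eq_zero (hm 0).aemeasurable h0] at hv
    have hv' : ∫ c, Y c ^ 2 ∂p = 0 := by
      rw [← hv, ← (hmp 0).map_eq, integral_map (hmp 0).measurable.aemeasurable
        (hYm.pow_const 2).aestronglyMeasurable]
    rw [integral_eq_zero_iff_of_nonneg (fun c => sq_nonneg _) hsq] at hv'
    obtain ⟨c⟩ : Nonempty 𝒜 := by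
      by_contra h
      rw [not_nonempty_iff] at h
      have := measure_univ (μ := p)
      simp [univ_eq_empty_iff.2 h] at this
    have : p {c} = 0 := by
      refine measure_mono_null ?_ (ae_iff.1 hv')
      intro d hd
      simp [hY]
    exact (hp c).ne' this

end prob19

/-- The Bonifant–Milnor one-step skew product with fractional-linear fiber maps
(zero Schwarzian derivative) has historical behavior almost everywhere:
for every `x ∈ (0,1)`, for `ℙ`-a.e. `ω` the Birkhoff averages have `liminf = 0` and
`limsup = 1`; in particular they do not converge. -/
theorem statement19 {𝒜 : Type*} [Countable 𝒜] [MeasurableSpace 𝒜] [MeasurableSingletonClass 𝒜]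
    (p : Measure 𝒜) [IsProbabilityMeasure p] (hp : ∀ c : 𝒜, 0 < p {c})
    (ℙ : Measure (ℕ → 𝒜)) [IsProbabilityMeasure ℙ] (hPr : IsBernoulli p ℙ)
    (a : 𝒜 → ℝ) (ha_pos : ∀ c, 0 < a c) (ha_ne : ∀ c, a c ≠ 1)
    (hlog_int : Integrable (fun c => Real.log (a c)) p)
    (hlog_mean : ∫ c, Real.log (a c) ∂p = 0)
    (hlog_sq : Integrable (fun c => (Real.log (a c)) ^ 2) p) :
    ∀ x ∈ Ioo (0:ℝ) 1, ∀ᵐ ω ∂ℙ,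
      Filter.liminf (fun n : ℕ => (n:ℝ)⁻¹ * ∑ j ∈ Finset.range n,
        fib (fun c y => a c * y / (1 + (a c - 1) * y)) ω j x) atTop = 0 ∧
      Filter.limsup (fun n : ℕ => (n:ℝ)⁻¹ * ∑ j ∈ Finset.range n,
        fib (fun c y => a c * y / (1 + (a c - 1) * y)) ω j x) atTop = 1 ∧
      ¬ ∃ L : ℝ, Tendsto (fun n : ℕ => (n:ℝ)⁻¹ * ∑ j ∈ Finset.range n,
        fib (fun c y => a c * y / (1 + (a c - 1) * y)) ω j x) atTop (nhds L) := by
  intro x hx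
  have hne : ∀ c, Real.log (a c) ≠ 0 := fun c =>
    Real.log_ne_zero_of_pos_of_ne_one (ha_pos c) (ha_ne c)
  have h1 := bern_Ev19 p hp ℙ hPr (fun c => Real.log (a c)) hne hlog_mean hlog_sq
  have h2 := bern_Ev19 p hp ℙ hPr (fun c => - Real.log (a c)) (fun c => neg_ne_zero.2 (hne c))
    (by rw [integral_neg, hlog_mean, neg_zero]) (by simpa using hlog_sq)
  filter_upwards [h1, h2] with ω hω1 hω2
  refine final19 (r := x / (1 - x)) (s := fun j => ∑ i ∈ Finset.range j, Real.log (a (ω i)))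
    (div_pos hx.1 (by linarith [hx.2])) (fun j => fib_eq19 a ha_pos x hx ω j) hω1 ?_
  simpa only [Finset.sum_neg_distrib] using hω2
end
end
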